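/- arXiv:2402.05228 — 4 statements merged into one kernel-verified Lean document; each statement's English description precedes it below -/
import Mathlib

section
/- Let H be an m×n matrix over F₂, let i be a row index, and let H̃ be the single-row reduction of H at row i via a row expansion f of size r. Then for every vector c ∈ F₂^{n+r−1} with H̃·c = 0, the restriction of c to the first n coordinates is a codeword of C(H), i.e., H applied to this restriction is zero. -/
open Matrix

/-- The `r × (r-1)` matrix `T_r` over `F₂` with `(T_r)_{j,k} = 1` iff `j = k` or
`j = k + 1`; it is the transpose of a parity-check matrix of the `[r,1,r]`
binary repetition code. -/
def Trep (r : ℕ) : Matrix (Fin r) (Fin (r - 1)) (ZMod 2) :=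
  Matrix.of fun j k => if (j : ℕ) = (k : ℕ) ∨ (j : ℕ) = (k : ℕ) + 1 then 1 else 0

/-- `f` is a row expansion of the row `h`: each column of `f` indexed by an element of the
support of `h` has Hamming weight exactly 1, and all other columns of `f` are zero. -/
def IsRowExpansion {κ : Type*} [Fintype κ] (h : κ → ZMod 2) {r : ℕ}
    (f : Matrix (Fin r) κ (ZMod 2)) : Prop :=
  ∀ j : κ, (h j ≠ 0 → hammingNorm (fun a => f a j) = 1) ∧ (h j = 0 → ∀ a, f a j = 0)

/-- The single-row reduction of `H` at row `i` via the expansion `f`: the rows of `H`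
other than row `i` are kept (extended by zeros in the new columns), and row `i` is
replaced by the block `(f | T_r)`. -/
def singleRowReduction {m n : ℕ} (H : Matrix (Fin m) (Fin n) (ZMod 2)) (i : Fin m)
    {r : ℕ} (f : Matrix (Fin r) (Fin n) (ZMod 2)) :
    Matrix ({j : Fin m // j ≠ i} ⊕ Fin r) (Fin n ⊕ Fin (r - 1)) (ZMod 2) :=
  Matrix.of fun a b =>
    match a, b with
    | Sum.inl j, Sum.inl cc => H j.1 cc
    | Sum.inl _, Sum.inr _ => 0
    | Sum.inr a, Sum.inl cc => f a cc
    | Sum.inr a, Sum.inr k => Trep r a k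

/-- Over `F₂`, the sum of the entries of a vector is its Hamming weight modulo 2. -/
lemma sum_eq_hammingNorm {ι : Type*} [Fintype ι] (x : ι → ZMod 2) :
    ∑ a, x a = (hammingNorm x : ZMod 2) := by
  have h : ∀ y : ZMod 2, y = if y ≠ 0 then 1 else 0 := by decide
  rw [hammingNorm, Finset.card_filter, Nat.cast_sum]
  refine Finset.sum_congr rfl fun a _ => ?_
  simpa using h (x a)

/-- The columns of a row expansion of `h` sum to the entries of `h`. -/
lemma IsRowExpansion.sum_column {κ : Type*} [Fintype κ] {h : κ → ZMod 2} {r : ℕ}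
    {f : Matrix (Fin r) κ (ZMod 2)} (hf : IsRowExpansion h f) (j : κ) :
    ∑ a, f a j = h j := by
  by_cases hj : h j = 0
  · simp [(hf j).2 hj, hj]
  · have h1 : ∀ y : ZMod 2, y ≠ 0 → y = 1 := by decide
    rw [sum_eq_hammingNorm, (hf j).1 hj, h1 _ hj, Nat.cast_one]

/-- The columns of `T_r` sum to zero. -/
lemma Trep_sum_column {r : ℕ} (k : Fin (r - 1)) : ∑ a, Trep r a k = 0 := by
  have hk := k.isLt
  have hT : ∀ a : Fin r, Trep r a k =
      (if a = ⟨k, by omega⟩ then 1 else 0) + (if a = ⟨k + 1, by omega⟩ then 1 else 0) := by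
    intro a
    simp only [Trep, Matrix.of_apply, Fin.ext_iff]
    split_ifs <;> first | omega | simp
  simp only [hT, Finset.sum_add_distrib, Finset.sum_ite_eq',
    Finset.mem_univ, if_true]
  decide

/-- Every codeword of the single-row reduction of `H` restricts, on the original `n`
coordinates, to a codeword of `C(H)`. -/
theorem stmt0 {m n r : ℕ} (hr : 2 ≤ r)
    (H : Matrix (Fin m) (Fin n) (ZMod 2)) (i : Fin m)
    (f : Matrix (Fin r) (Fin n) (ZMod 2)) (hf : IsRowExpansion (H i) f)
    (c : (Fin n ⊕ Fin (r - 1)) → ZMod 2)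
    (hc : (singleRowReduction H i f).mulVec c = 0) :
    H.mulVec (fun j => c (Sum.inl j)) = 0 := by
  funext j
  by_cases hj : j = i
  · subst hj
    have hsum : ∑ a : Fin r, (singleRowReduction H j f).mulVec c (Sum.inr a) = 0 := by
      simp [hc]
    simp only [mulVec, dotProduct, singleRowReduction, Matrix.of_apply,
      Fintype.sum_sum_type, Finset.sum_add_distrib] at hsum
    rw [Finset.sum_comm, Finset.sum_comm (s := Finset.univ (α := Fin r))] at hsum
    simpa only [mulVec, dotProduct, Pi.zero_apply, ← Finset.sum_mul, hf.sum_column,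
      Trep_sum_column, zero_mul, Finset.sum_const_zero, add_zero] using hsum
  · simpa [mulVec, dotProduct, singleRowReduction] using congrFun hc (Sum.inl ⟨j, hj⟩)
end

section
/- Let H be an m×n matrix over F₂, let i be a row index with w = wt(h_i) ≥ 2, and let H̃ be the single-row reduction of H at row i via a row expansion f of size r = w in which, additionally, every row of f has Hamming weight exactly 1 (so f is a permutation-embedding of the support of h_i). Then: (1) every one of the r new rows of H̃ has Hamming weight at most 3; (2) for each of the first n columns, the column Hamming weight of H̃ equals the column Hamming weight of H; and (3) each of the r−1 new columns of H̃ has Hamming weight exactly 2. -/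
open Matrix

/-- The Hamming norm of a vector indexed by a sum type is the sum of the norms of its parts. -/
theorem hammingNorm_sum_index {α β R : Type*} [Fintype α] [Fintype β] [DecidableEq R] [Zero R]
    (v : α ⊕ β → R) :
    hammingNorm v = hammingNorm (fun a => v (Sum.inl a)) + hammingNorm (fun b => v (Sum.inr b)) := by
  simp only [hammingNorm, Finset.card_filter, Fintype.sum_sum_type]

/-- Splitting off one coordinate from the Hamming norm. -/
theorem hammingNorm_eq_add_ite {α R : Type*} [Fintype α] [DecidableEq α] [DecidableEq R] [Zero R]
    (v : α → R) (i : α) :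
    hammingNorm v =
      hammingNorm (fun a : {a : α // a ≠ i} => v a) + if v i ≠ 0 then 1 else 0 := by
  simp only [hammingNorm, Finset.card_filter]
  rw [Fintype.sum_eq_add_sum_subtype_ne _ i, add_comm]

theorem hammingNorm_Trep_row_le {r : ℕ} (a : Fin r) : hammingNorm (Trep r a) ≤ 2 := by
  have hsub : (Finset.univ.filter fun k => Trep r a k ≠ 0).map Fin.valEmbedding ⊆
      {(a : ℕ), (a : ℕ) - 1} := by
    intro x hx
    obtain ⟨k, hk, rfl⟩ := Finset.mem_map.1 hx
    have : (a : ℕ) = k ∨ (a : ℕ) = k + 1 := by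
      by_contra h
      exact (Finset.mem_filter.1 hk).2 (if_neg h)
    simp only [Fin.valEmbedding_apply, Finset.mem_insert, Finset.mem_singleton]
    omega
  have hcard := Finset.card_le_card hsub
  rw [Finset.card_map] at hcard
  exact hcard.trans Finset.card_le_two

theorem hammingNorm_Trep_col {r : ℕ} (k : Fin (r - 1)) :
    hammingNorm (fun a => Trep r a k) = 2 := by
  have hk := k.isLt
  have hset : (Finset.univ.filter fun a => Trep r a k ≠ 0) =
      {⟨k, by omega⟩, ⟨k + 1, by omega⟩} := by
    ext a
    simp [Trep, Fin.ext_iff, or_iff_not_imp_left]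
  rw [hammingNorm, hset, Finset.card_pair]
  simp [Fin.ext_iff]

/-- Each column of a row expansion has weight one on the support and zero off it. -/
theorem IsRowExpansion.hammingNorm_col {κ : Type*} [Fintype κ] {h : κ → ZMod 2} {r : ℕ}
    {f : Matrix (Fin r) κ (ZMod 2)} (hf : IsRowExpansion h f) (j : κ) :
    hammingNorm (fun a => f a j) = if h j ≠ 0 then 1 else 0 := by
  split_ifs with hj
  · exact (hf j).1 hj
  · exact hammingNorm_eq_zero.2 (funext ((hf j).2 (not_not.1 hj)))

/-- For the single-row reduction at a row of weight `w = wt(H i) ≥ 2` via a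
permutation-embedding expansion of size `r = w` (every row of `f` has weight exactly 1):
(1) every new row of `H̃` has Hamming weight at most 3;
(2) each of the first `n` columns of `H̃` has the same Hamming weight as the
corresponding column of `H`; and
(3) each of the `r - 1` new columns of `H̃` has Hamming weight exactly 2. -/
theorem stmt3 {m n : ℕ}
    (H : Matrix (Fin m) (Fin n) (ZMod 2)) (i : Fin m)
    (hw : 2 ≤ hammingNorm (H i))
    (f : Matrix (Fin (hammingNorm (H i))) (Fin n) (ZMod 2))
    (hf : IsRowExpansion (H i) f)
    (hunit : ∀ a, hammingNorm (f a) = 1) :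
    (∀ a : Fin (hammingNorm (H i)),
        hammingNorm (singleRowReduction H i f (Sum.inr a)) ≤ 3) ∧
    (∀ j : Fin n,
        hammingNorm ((singleRowReduction H i f)ᵀ (Sum.inl j)) = hammingNorm (Hᵀ j)) ∧
    (∀ k : Fin (hammingNorm (H i) - 1),
        hammingNorm ((singleRowReduction H i f)ᵀ (Sum.inr k)) = 2) := by
  refine ⟨fun a => ?_, fun j => ?_, fun k => ?_⟩
  · rw [hammingNorm_sum_index]
    change hammingNorm (f a) + hammingNorm (Trep _ a) ≤ 3
    have := hammingNorm_Trep_row_le a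
    have := hunit a
    omega
  · rw [hammingNorm_sum_index, hammingNorm_eq_add_ite (Hᵀ j) i]
    exact congrArg _ (hf.hammingNorm_col j)
  · rw [hammingNorm_sum_index]
    change hammingNorm (0 : {j : Fin m // j ≠ i} → ZMod 2) +
      hammingNorm (fun a => Trep _ a k) = 2
    rw [hammingNorm_zero, hammingNorm_Trep_col]
end

section
/- Let H be an m×n matrix over F₂ in which every column is nonzero and every row has Hamming weight strictly greater than 3, and let H̃ be the full row reduction of H in which each expansion f_i is a permutation-embedding (every row of f_i has Hamming weight exactly 1 and r_i = wt(h_i)). Then every nonzero codeword of C(H̃) has Hamming weight at least (3/2)·d(H); i.e., 2·d(H̃) ≥ 3·d(H). -/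
open Matrix

/-- The full row reduction via expansions `f i` of sizes `r i`: rows are indexed by the
disjoint union `⨆ i, Fin (r i)` and columns by `κ ⊕ ⨆ i, Fin (r i - 1)`; the `i`-th block
of rows equals `f i` on the original columns, equals `T_{r i}` on the `i`-th block of new
columns, and is zero on all other new-column blocks. -/
def fullRowReduction {ι κ : Type*} [DecidableEq ι]
    (r : ι → ℕ) (f : ∀ i, Matrix (Fin (r i)) κ (ZMod 2)) :
    Matrix ((i : ι) × Fin (r i)) (κ ⊕ (i : ι) × Fin (r i - 1)) (ZMod 2) :=
  Matrix.of fun a b =>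
    match b with
    | Sum.inl cc => f a.1 a.2 cc
    | Sum.inr k =>
        if a.1 = k.1 ∧ ((a.2 : ℕ) = (k.2 : ℕ) ∨ (a.2 : ℕ) = (k.2 : ℕ) + 1) then 1 else 0

/-- The full column reduction via expansions `f j` (of the columns, i.e. of the rows of
the transpose) of sizes `r j`: the transpose of the full row reduction of the transpose. -/
def fullColumnReduction {ι κ : Type*} [DecidableEq κ]
    (r : κ → ℕ) (f : ∀ j, Matrix (Fin (r j)) ι (ZMod 2)) :
    Matrix (ι ⊕ (j : κ) × Fin (r j - 1)) ((j : κ) × Fin (r j)) (ZMod 2) :=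
  (fullRowReduction r f)ᵀ

/-- The minimum distance of the code `C(H)`: the least Hamming weight of a nonzero
vector in the kernel of `H`. -/
noncomputable def minDist {ι κ : Type*} [Fintype ι] [Fintype κ]
    (H : Matrix ι κ (ZMod 2)) : ℕ :=
  sInf {w | ∃ v : κ → ZMod 2, v ≠ 0 ∧ H.mulVec v = 0 ∧ hammingNorm v = w}

section RowReduction

variable {ι κ : Type*} [Fintype ι] [DecidableEq ι] [Fintype κ]

theorem fullRowReduction_mulVec_apply (r : ι → ℕ) (f : ∀ i, Matrix (Fin (r i)) κ (ZMod 2))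
    (c : (κ ⊕ (i : ι) × Fin (r i - 1)) → ZMod 2) (i : ι) (a : Fin (r i)) :
    (fullRowReduction r f).mulVec c ⟨i, a⟩ =
      (f i).mulVec (c ∘ Sum.inl) a +
        ∑ k : Fin (r i - 1),
          if (a : ℕ) = k ∨ (a : ℕ) = k + 1 then c (Sum.inr ⟨i, k⟩) else 0 := by
  simp only [Matrix.mulVec, dotProduct, fullRowReduction, Fintype.sum_sum_type, Matrix.of_apply,
    Fintype.sum_sigma, Function.comp_apply, ite_mul, one_mul, zero_mul]
  congr 1
  rw [Finset.sum_eq_single i]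
  · simp
  · intro b _ hb
    simp [hb.symm]
  · simp

theorem sum_consecutive_eq_zero {r : ℕ} (k : Fin (r - 1)) (x : ZMod 2) :
    ∑ a : Fin r, (if (a : ℕ) = k ∨ (a : ℕ) = k + 1 then x else 0) = 0 := by
  have hk := k.2
  have hsplit : ∀ a ∈ Finset.range r, (if a = (k : ℕ) ∨ a = k + 1 then x else 0) =
      (if a = (k : ℕ) then x else 0) + if a = k + 1 then x else 0 := by
    intro a _
    split_ifs <;> first | omega | simp
  rw [Fin.sum_univ_eq_sum_range (fun a => if a = (k : ℕ) ∨ a = k + 1 then x else 0),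
    Finset.sum_congr rfl hsplit, Finset.sum_add_distrib, Finset.sum_ite_eq', Finset.sum_ite_eq',
    if_pos (Finset.mem_range.2 (by omega)), if_pos (Finset.mem_range.2 (by omega))]
  exact CharTwo.add_self_eq_zero x

theorem sum_consecutive_partial_sums {r : ℕ} (g : ℕ → ZMod 2)
    (hg : ∑ x ∈ Finset.range r, g x = 0) (a : Fin r) :
    ∑ k : Fin (r - 1), (if (a : ℕ) = k ∨ (a : ℕ) = k + 1 then
      ∑ x ∈ Finset.range (k + 1), g x else 0) = g a := by
  obtain ⟨a, ha⟩ := a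
  have hsplit : ∀ k ∈ Finset.range (r - 1),
      (if a = k ∨ a = k + 1 then ∑ x ∈ Finset.range (k + 1), g x else 0) =
      (if a = k then ∑ x ∈ Finset.range (k + 1), g x else 0) +
        if a = k + 1 then ∑ x ∈ Finset.range (k + 1), g x else 0 := by
    intro k _
    split_ifs <;> first | omega | simp
  have hfirst : ∑ k ∈ Finset.range (r - 1),
      (if a = k then ∑ x ∈ Finset.range (k + 1), g x else 0) =
        ∑ x ∈ Finset.range (a + 1), g x := by
    rw [Finset.sum_ite_eq]
    split_ifs with h
    · rfl
    · rw [Finset.mem_range] at h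
      rw [show a + 1 = r by omega, hg]
  have hsecond : ∑ k ∈ Finset.range (r - 1),
      (if a = k + 1 then ∑ x ∈ Finset.range (k + 1), g x else 0) =
        ∑ x ∈ Finset.range a, g x := by
    cases a with
    | zero => simp
    | succ b =>
      simp only [Nat.add_right_cancel_iff]
      rw [Finset.sum_ite_eq, if_pos (Finset.mem_range.2 (by omega))]
  rw [Fin.sum_univ_eq_sum_range
      (fun k => if a = k ∨ a = k + 1 then ∑ x ∈ Finset.range (k + 1), g x else 0),
    Finset.sum_congr rfl hsplit, Finset.sum_add_distrib, hfirst, hsecond, Finset.sum_range_succ,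
    add_right_comm, CharTwo.add_self_eq_zero, zero_add]

theorem IsRowExpansion.sum_col {h : κ → ZMod 2} {r : ℕ} {f : Matrix (Fin r) κ (ZMod 2)}
    (hf : IsRowExpansion h f) (j : κ) : ∑ a, f a j = h j := by
  have h01 : ∀ x : ZMod 2, x ≠ 0 → x = 1 := by decide
  by_cases hj : h j = 0
  · simp [(hf j).2 hj, hj]
  · obtain ⟨a, ha⟩ := Finset.card_eq_one.1 ((hf j).1 hj)
    have hmem : ∀ b, f b j ≠ 0 ↔ b = a := fun b => by
      simpa using Finset.ext_iff.1 ha b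
    rw [Finset.sum_eq_single a (fun b _ hb => not_not.1 (mt (hmem b).1 hb)) (by simp),
      h01 _ ((hmem a).2 rfl), h01 _ hj]

theorem IsRowExpansion.sum_mulVec {h : κ → ZMod 2} {r : ℕ} {f : Matrix (Fin r) κ (ZMod 2)}
    (hf : IsRowExpansion h f) (v : κ → ZMod 2) : ∑ a, f.mulVec v a = h ⬝ᵥ v := by
  simp only [Matrix.mulVec, dotProduct]
  rw [Finset.sum_comm]
  simp only [← Finset.sum_mul, hf.sum_col]

theorem mulVec_comp_inl_eq_zero {H : Matrix ι κ (ZMod 2)} {r : ι → ℕ}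
    {f : ∀ i, Matrix (Fin (r i)) κ (ZMod 2)} (hf : ∀ i, IsRowExpansion (H i) (f i))
    {c : (κ ⊕ (i : ι) × Fin (r i - 1)) → ZMod 2} (hc : (fullRowReduction r f).mulVec c = 0) :
    H.mulVec (c ∘ Sum.inl) = 0 := by
  funext i
  have hsum : ∑ a, (fullRowReduction r f).mulVec c ⟨i, a⟩ = 0 := by simp [hc]
  simp only [fullRowReduction_mulVec_apply, Finset.sum_add_distrib, (hf i).sum_mulVec] at hsum
  rw [Finset.sum_comm] at hsum
  simp only [sum_consecutive_eq_zero, Finset.sum_const_zero, add_zero] at hsum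
  exact hsum

theorem comp_inl_ne_zero {r : ι → ℕ} {f : ∀ i, Matrix (Fin (r i)) κ (ZMod 2)}
    {c : (κ ⊕ (i : ι) × Fin (r i - 1)) → ZMod 2} (hc0 : c ≠ 0)
    (hc : (fullRowReduction r f).mulVec c = 0) : c ∘ Sum.inl ≠ 0 := by
  intro hv
  apply hc0
  have hnew : ∀ (i : ι) (k : ℕ) (hk : k < r i - 1), c (Sum.inr ⟨i, ⟨k, hk⟩⟩) = 0 := by
    intro i k
    induction k using Nat.strong_induction_on with
    | _ k ih =>
      intro hk
      have hrow := congrFun hc ⟨i, ⟨k, by omega⟩⟩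
      rw [fullRowReduction_mulVec_apply, hv, Matrix.mulVec_zero, Pi.zero_apply, zero_add,
        Finset.sum_eq_single ⟨k, hk⟩] at hrow
      · simpa using hrow
      · rintro ⟨l, hl⟩ _ hne
        have hlk : k ≠ l := fun h => hne (Fin.ext h.symm)
        split_ifs with h
        · exact ih l (by simp only at h; omega) hl
        · rfl
      · simp
  funext b
  rcases b with j | ⟨i, k, hk⟩
  · exact congrFun hv j
  · exact hnew i k hk

theorem exists_extension_mulVec_eq_zero {H : Matrix ι κ (ZMod 2)} {r : ι → ℕ}
    {f : ∀ i, Matrix (Fin (r i)) κ (ZMod 2)} (hf : ∀ i, IsRowExpansion (H i) (f i))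
    {v : κ → ZMod 2} (hv : H.mulVec v = 0) :
    ∃ w, (fullRowReduction r f).mulVec (Sum.elim v w) = 0 := by
  let g : ι → ℕ → ZMod 2 := fun i x => if hx : x < r i then (f i).mulVec v ⟨x, hx⟩ else 0
  refine ⟨fun k => ∑ x ∈ Finset.range (k.2 + 1), g k.1 x, ?_⟩
  funext ⟨i, a⟩
  have hg : ∀ a : Fin (r i), g i a = (f i).mulVec v a := fun a => by simp [g]
  have hsum : ∑ x ∈ Finset.range (r i), g i x = 0 := by
    rw [← Fin.sum_univ_eq_sum_range, Finset.sum_congr rfl fun a _ => hg a, (hf i).sum_mulVec]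
    exact congrFun hv i
  rw [fullRowReduction_mulVec_apply, Sum.elim_comp_inl]
  simp only [Sum.elim_inr]
  rw [sum_consecutive_partial_sums (g i) hsum a, hg]
  exact CharTwo.add_self_eq_zero _

theorem hammingNorm_comp_inl_le {H : Matrix ι κ (ZMod 2)} (hcols : ∀ j, ∃ i, H i j ≠ 0)
    {r : ι → ℕ} {f : ∀ i, Matrix (Fin (r i)) κ (ZMod 2)}
    (hf : ∀ i, IsRowExpansion (H i) (f i)) (hunit : ∀ i a, hammingNorm (f i a) = 1)
    {c : (κ ⊕ (i : ι) × Fin (r i - 1)) → ZMod 2} (hc : (fullRowReduction r f).mulVec c = 0) :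
    hammingNorm (c ∘ Sum.inl) ≤ 2 * hammingNorm (c ∘ Sum.inr) := by
  have hrow : ∀ i (a : Fin (r i)) j j', f i a j ≠ 0 → f i a j' ≠ 0 → j = j' := by
    intro i a j j' hj hj'
    exact Finset.card_le_one.1 (hunit i a).le j (by simpa using hj) j' (by simpa using hj')
  have hcard := Finset.card_le_card_of_forall_subsingleton
    (s := Finset.univ.filter fun j => c (Sum.inl j) ≠ 0)
    (t := (Finset.univ.filter fun k => c (Sum.inr k) ≠ 0) ×ˢ Finset.range 2)
    (fun j p => ∃ a : Fin (r p.1.1), f p.1.1 a j ≠ 0 ∧ (a : ℕ) = p.1.2 + p.2) ?_ ?_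
  · rw [Finset.card_product, Finset.card_range, mul_comm] at hcard
    exact hcard
  · intro j hj
    replace hj : c (Sum.inl j) ≠ 0 := by simpa using hj
    obtain ⟨i, hi⟩ := hcols j
    obtain ⟨a, ha⟩ : ∃ a, f i a j ≠ 0 := by
      by_contra! h
      exact hi (by rw [← (hf i).sum_col j]; simp [h])
    have hfv : (f i).mulVec (c ∘ Sum.inl) a ≠ 0 := by
      rw [Matrix.mulVec, dotProduct, Finset.sum_eq_single j]
      · exact mul_ne_zero ha hj
      · intro l _ hl
        rw [not_not.1 fun h => hl (hrow i a l j h ha), zero_mul]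
      · simp
    have hT := congrFun hc ⟨i, a⟩
    rw [fullRowReduction_mulVec_apply] at hT
    obtain ⟨k, -, hk⟩ := Finset.exists_ne_zero_of_sum_ne_zero fun h =>
      hfv (by rwa [h, add_zero] at hT)
    obtain ⟨hak, hk⟩ := ite_ne_right_iff.1 hk
    refine ⟨(⟨i, k⟩, a - k), ?_, a, ha, by simp only; omega⟩
    rw [Finset.mem_product, Finset.mem_filter, Finset.mem_range]
    exact ⟨⟨Finset.mem_univ _, hk⟩, show (a : ℕ) - k < 2 by omega⟩
  · rintro p - j ⟨-, a, ha, hap⟩ j' ⟨-, a', ha', hap'⟩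
    obtain rfl : a = a' := Fin.ext (hap.trans hap'.symm)
    exact hrow _ a j j' ha ha'

theorem hammingNorm_sum_eq {α β : Type*} [Fintype α] [Fintype β] (c : α ⊕ β → ZMod 2) :
    hammingNorm c = hammingNorm (c ∘ Sum.inl) + hammingNorm (c ∘ Sum.inr) := by
  simp only [hammingNorm, Finset.card_filter, Fintype.sum_sum_type, Function.comp_apply]

end RowReduction

/-- If every column of `H` is nonzero and every row of `H` has weight `> 3`, then for the
full row reduction `H̃` with permutation-embedding expansions (every row of each `f i` has
weight exactly 1, and `r i = wt(H i)`), every nonzero codeword of `C(H̃)` has Hamming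
weight at least `(3/2)·d(H)`, i.e. `2·d(H̃) ≥ 3·d(H)`. -/
theorem stmt4 {m n : ℕ}
    (H : Matrix (Fin m) (Fin n) (ZMod 2))
    (hcols : ∀ j : Fin n, ∃ a, H a j ≠ 0)
    (hrows : ∀ i : Fin m, 3 < hammingNorm (H i))
    (r : Fin m → ℕ) (hr : ∀ i, r i = hammingNorm (H i))
    (f : ∀ i, Matrix (Fin (r i)) (Fin n) (ZMod 2))
    (hf : ∀ i, IsRowExpansion (H i) (f i))
    (hunit : ∀ i a, hammingNorm (f i a) = 1) :
    (∀ c : (Fin n ⊕ (i : Fin m) × Fin (r i - 1)) → ZMod 2, c ≠ 0 →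
        (fullRowReduction r f).mulVec c = 0 →
        3 * minDist H ≤ 2 * hammingNorm c) ∧
    3 * minDist H ≤ 2 * minDist (fullRowReduction r f) := by
  have hword : ∀ c : (Fin n ⊕ (i : Fin m) × Fin (r i - 1)) → ZMod 2, c ≠ 0 →
      (fullRowReduction r f).mulVec c = 0 → 3 * minDist H ≤ 2 * hammingNorm c := by
    intro c hc0 hc
    have hdist : minDist H ≤ hammingNorm (c ∘ Sum.inl) :=
      Nat.sInf_le ⟨_, comp_inl_ne_zero hc0 hc, mulVec_comp_inl_eq_zero hf hc, rfl⟩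
    have hle := hammingNorm_comp_inl_le hcols hf hunit hc
    have hsum := hammingNorm_sum_eq c
    omega
  refine ⟨hword, ?_⟩
  rcases Set.eq_empty_or_nonempty {w | ∃ v : Fin n → ZMod 2,
      v ≠ 0 ∧ H.mulVec v = 0 ∧ hammingNorm v = w} with hempty | ⟨-, v, hv0, hv, -⟩
  · simp [minDist, hempty]
  · obtain ⟨w, hw⟩ := exists_extension_mulVec_eq_zero hf hv
    have hne : Sum.elim v w ≠ 0 := fun h => hv0 (funext fun j => congrFun h (Sum.inl j))
    obtain ⟨c, hc0, hc, hcd⟩ := Nat.sInf_mem (s := {d | ∃ c, c ≠ 0 ∧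
      (fullRowReduction r f).mulVec c = 0 ∧ hammingNorm c = d}) ⟨_, _, hne, hw, rfl⟩
    exact (hword c hc0 hc).trans_eq (congrArg (2 * ·) hcd)
end

section
/- Let s ≥ 1 and c ≥ 0, and let G be the copying gadget graph on vertex set {v_1,…,v_s} ∪ {z_1,…,z_c} ∪ {x_1,…,x_{s−1}} with edges: z_j adjacent to v_k for all j,k; and x_j adjacent to v_j and to v_{j+1} for 1 ≤ j ≤ s−1; and no other edges. Then the number of 4-cycles of G containing no x-vertex equals C(s,2)·C(c,2), the number of 4-cycles of G containing at least one x-vertex equals c·(s−1), and hence the total number of 4-cycles of G equals C(s,2)·C(c,2) + c·(s−1). (This is the count of new 4-cycles introduced when copying splits a variable node of Z-check degree c into s copies linked by s−1 weight-2 X checks.) -/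
/-- The copying gadget graph on vertex set `{v_1,…,v_s} ∪ {z_1,…,z_c} ∪ {x_1,…,x_{s-1}}`
(encoded as `Fin s ⊕ Fin c ⊕ Fin (s-1)`): every `z_j` is adjacent to every `v_k`, and
each `x_j` is adjacent to `v_j` and `v_{j+1}`; there are no other edges. -/
def copyGadget (s c : ℕ) : SimpleGraph (Fin s ⊕ Fin c ⊕ Fin (s - 1)) :=
  SimpleGraph.fromRel fun a b =>
    match a, b with
    | Sum.inl _, Sum.inr (Sum.inl _) => True
    | Sum.inl v, Sum.inr (Sum.inr x) => (v : ℕ) = (x : ℕ) ∨ (v : ℕ) = (x : ℕ) + 1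
    | _, _ => False

/-- `S` is a 4-cycle of `G`: a 4-element vertex subset that can be ordered so that
consecutive vertices (cyclically) are adjacent and the two non-consecutive pairs are
non-adjacent, i.e. the induced subgraph on `S` is a cycle of length 4. -/
def IsFourCycle {V : Type*} [DecidableEq V] (G : SimpleGraph V) (S : Finset V) : Prop :=
  ∃ a b d e : V, S = {a, b, d, e} ∧
    a ≠ b ∧ a ≠ d ∧ a ≠ e ∧ b ≠ d ∧ b ≠ e ∧ d ≠ e ∧
    G.Adj a b ∧ G.Adj b d ∧ G.Adj d e ∧ G.Adj e a ∧ ¬ G.Adj a d ∧ ¬ G.Adj b e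

/-- A vertex of the copying gadget graph is an `x`-vertex. -/
def isXVertex {s c : ℕ} (v : Fin s ⊕ Fin c ⊕ Fin (s - 1)) : Prop :=
  ∃ x : Fin (s - 1), v = Sum.inr (Sum.inr x)

namespace copyGadget

variable {s c : ℕ}

@[simp]
lemma not_adj_inl_inl (p q : Fin s) :
    ¬ (copyGadget s c).Adj (Sum.inl p) (Sum.inl q) := by
  simp [copyGadget]

@[simp]
lemma not_adj_inr_inr (y y' : Fin c ⊕ Fin (s - 1)) :
    ¬ (copyGadget s c).Adj (Sum.inr y) (Sum.inr y') := by
  simp [copyGadget]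

@[simp]
lemma adj_inl_inr_inl (p : Fin s) (z : Fin c) :
    (copyGadget s c).Adj (Sum.inl p) (Sum.inr (Sum.inl z)) := by
  simp [copyGadget]

@[simp]
lemma adj_inl_inr_inr (p : Fin s) (x : Fin (s - 1)) :
    (copyGadget s c).Adj (Sum.inl p) (Sum.inr (Sum.inr x)) ↔
      (p : ℕ) = x ∨ (p : ℕ) = x + 1 := by
  simp [copyGadget]

/-- A 4-cycle of the copying gadget alternates between two `v`-vertices and two checks. -/
lemma isFourCycle_iff (S : Finset (Fin s ⊕ Fin c ⊕ Fin (s - 1))) :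
    IsFourCycle (copyGadget s c) S ↔
      ∃ (p q : Fin s) (y y' : Fin c ⊕ Fin (s - 1)), p ≠ q ∧ y ≠ y' ∧
        (copyGadget s c).Adj (Sum.inl p) (Sum.inr y) ∧
        (copyGadget s c).Adj (Sum.inl q) (Sum.inr y) ∧
        (copyGadget s c).Adj (Sum.inl p) (Sum.inr y') ∧
        (copyGadget s c).Adj (Sum.inl q) (Sum.inr y') ∧
        S = ({p, q} : Finset (Fin s)).disjSum {y, y'} := by
  constructor
  · rintro ⟨a, b, d, e, rfl, hab, had, hae, hbd, hbe, hde, h1, h2, h3, h4, -, -⟩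
    rcases a with p | y
    · rcases b with _ | y
      · simp at h1
      rcases d with q | _
      swap
      · simp at h2
      rcases e with _ | y'
      · simp at h3
      refine ⟨p, q, y, y', by simpa using had, by simpa using hbe, h1, h2.symm, h4.symm, h3, ?_⟩
      ext (w | w) <;> simp
    · rcases b with p | _
      swap
      · simp at h1
      rcases d with _ | y'
      · simp at h2
      rcases e with q | _
      swap
      · simp at h3
      refine ⟨p, q, y, y', by simpa using hbe, by simpa using had, h1.symm, h4, h2, h3.symm, ?_⟩
      ext (w | w) <;> simp
  · rintro ⟨p, q, y, y', hpq, hy, h1, h2, h3, h4, rfl⟩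
    refine ⟨Sum.inl p, Sum.inr y, Sum.inl q, Sum.inr y', ?_, by simp, by simpa using hpq, by simp,
      by simp, by simpa using hy, by simp, h1, h2.symm, h4, h3.symm, by simp, by simp⟩
    ext (w | w) <;> simp

/-- The 4-cycles without `x`-vertex are given by a pair of `v`-vertices and a pair of
`z`-vertices. -/
lemma ncard_fourCycles_without_x (s c : ℕ) :
    {S : Finset (Fin s ⊕ Fin c ⊕ Fin (s - 1)) |
        IsFourCycle (copyGadget s c) S ∧ ∀ v ∈ S, ¬ isXVertex v}.ncard
      = Nat.choose s 2 * Nat.choose c 2 := by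
  have key : {S : Finset (Fin s ⊕ Fin c ⊕ Fin (s - 1)) |
        IsFourCycle (copyGadget s c) S ∧ ∀ v ∈ S, ¬ isXVertex v} =
      (fun P : Finset (Fin s) × Finset (Fin c) =>
        P.1.disjSum (P.2.disjSum (∅ : Finset (Fin (s - 1))))) ''
        ((Finset.univ.powersetCard 2 ×ˢ Finset.univ.powersetCard 2 :
          Finset (Finset (Fin s) × Finset (Fin c))) : Set (Finset (Fin s) × Finset (Fin c))) := by
    ext S
    simp only [Set.mem_ofPred_eq, isFourCycle_iff, Set.mem_image, Finset.mem_coe,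
      Finset.mem_product, Finset.mem_powersetCard_univ, Finset.card_eq_two, Prod.exists]
    constructor
    · rintro ⟨⟨p, q, y, y', hpq, hy, -, -, -, -, rfl⟩, hx⟩
      rcases y with z | x
      swap
      · exact (hx (Sum.inr (Sum.inr x)) (by simp) ⟨x, rfl⟩).elim
      rcases y' with z' | x
      swap
      · exact (hx (Sum.inr (Sum.inr x)) (by simp) ⟨x, rfl⟩).elim
      refine ⟨{p, q}, {z, z'}, ⟨⟨p, q, hpq, rfl⟩, z, z', by simpa using hy, rfl⟩, ?_⟩
      ext (w | w | w) <;> simp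
    · rintro ⟨_, _, ⟨⟨p, q, hpq, rfl⟩, z, z', hz, rfl⟩, rfl⟩
      refine ⟨⟨p, q, Sum.inl z, Sum.inl z', hpq, by simpa using hz, by simp, by simp, by simp,
        by simp, ?_⟩, ?_⟩
      · ext (w | w | w) <;> simp
      · rintro v hv ⟨x, rfl⟩
        simp at hv
  rw [key, Set.ncard_image_of_injective, Set.ncard_coe_finset, Finset.card_product]
  · simp
  · rintro ⟨A, B⟩ ⟨A', B'⟩ h
    simp only [Finset.ext_iff, Sum.forall, Finset.inl_mem_disjSum, Finset.inr_mem_disjSum] at h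
    exact Prod.ext (Finset.ext h.1) (Finset.ext h.2.1)

/-- The 4-cycle through the vertices `z` and `x`. -/
def mixedCycle (P : Fin c × Fin (s - 1)) : Finset (Fin s ⊕ Fin c ⊕ Fin (s - 1)) :=
  ({⟨P.2, by omega⟩, ⟨P.2 + 1, by omega⟩} : Finset (Fin s)).disjSum
    (({P.1} : Finset (Fin c)).disjSum {P.2})

lemma mixedCycle_injective :
    Function.Injective (mixedCycle : Fin c × Fin (s - 1) → _) := by
  rintro ⟨z, x⟩ ⟨z', x'⟩ h
  simp only [mixedCycle, Finset.ext_iff, Sum.forall, Finset.inl_mem_disjSum,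
    Finset.inr_mem_disjSum, Finset.mem_singleton] at h
  exact Prod.ext ((h.2.1 z).1 rfl) ((h.2.2 x).1 rfl)

lemma pair_eq_of_adj {p q : Fin s} {x : Fin (s - 1)} (hpq : p ≠ q)
    (hp : (p : ℕ) = x ∨ (p : ℕ) = x + 1) (hq : (q : ℕ) = x ∨ (q : ℕ) = x + 1) :
    ({p, q} : Finset (Fin s)) = {⟨x, by omega⟩, ⟨x + 1, by omega⟩} := by
  ext w
  simp only [Finset.mem_insert, Finset.mem_singleton, Fin.ext_iff, ne_eq] at *
  omega

/-- The 4-cycles with an `x`-vertex are given by that vertex and a `z`-vertex. -/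
lemma ncard_fourCycles_with_x (s c : ℕ) :
    {S : Finset (Fin s ⊕ Fin c ⊕ Fin (s - 1)) |
        IsFourCycle (copyGadget s c) S ∧ ∃ v ∈ S, isXVertex v}.ncard
      = c * (s - 1) := by
  have key : {S : Finset (Fin s ⊕ Fin c ⊕ Fin (s - 1)) |
        IsFourCycle (copyGadget s c) S ∧ ∃ v ∈ S, isXVertex v} =
      Set.range mixedCycle := by
    ext S
    simp only [Set.mem_ofPred_eq, isFourCycle_iff, Set.mem_range, Prod.exists]
    constructor
    · rintro ⟨⟨p, q, y, y', hpq, hy, h1, h2, h3, h4, rfl⟩, v, hv, x₀, rfl⟩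
      rcases y with z | x <;> rcases y' with z' | x'
      · simp at hv
      · refine ⟨z, x', ?_⟩
        rw [pair_eq_of_adj hpq ((adj_inl_inr_inr _ _).1 h3) ((adj_inl_inr_inr _ _).1 h4)]
        ext (w | w | w) <;> simp [mixedCycle]
      · refine ⟨z', x, ?_⟩
        rw [pair_eq_of_adj hpq ((adj_inl_inr_inr _ _).1 h1) ((adj_inl_inr_inr _ _).1 h2)]
        ext (w | w | w) <;> simp [mixedCycle]
      · simp only [adj_inl_inr_inr, ne_eq, Sum.inr.injEq, Fin.ext_iff] at *
        omega
    · rintro ⟨z, x, rfl⟩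
      refine ⟨⟨⟨x, by omega⟩, ⟨x + 1, by omega⟩, Sum.inl z, Sum.inr x, by simp, by simp, by simp,
        by simp, by simp, by simp, ?_⟩, Sum.inr (Sum.inr x), by simp [mixedCycle], x, rfl⟩
      ext (w | w | w) <;> simp [mixedCycle]
  rw [key, Set.ncard_range_of_injective mixedCycle_injective]
  simp

end copyGadget

/-- In the copying gadget graph: the number of 4-cycles containing no `x`-vertex is
`C(s,2)·C(c,2)`, the number of 4-cycles containing at least one `x`-vertex is
`c·(s−1)`, and hence the total number of 4-cycles is `C(s,2)·C(c,2) + c·(s−1)`. -/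
theorem stmt14 (s c : ℕ) (hs : 1 ≤ s) :
    {S : Finset (Fin s ⊕ Fin c ⊕ Fin (s - 1)) |
        IsFourCycle (copyGadget s c) S ∧ ∀ v ∈ S, ¬ isXVertex v}.ncard
      = Nat.choose s 2 * Nat.choose c 2 ∧
    {S : Finset (Fin s ⊕ Fin c ⊕ Fin (s - 1)) |
        IsFourCycle (copyGadget s c) S ∧ ∃ v ∈ S, isXVertex v}.ncard
      = c * (s - 1) ∧
    {S : Finset (Fin s ⊕ Fin c ⊕ Fin (s - 1)) |
        IsFourCycle (copyGadget s c) S}.ncard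
      = Nat.choose s 2 * Nat.choose c 2 + c * (s - 1) := by
  refine ⟨copyGadget.ncard_fourCycles_without_x s c, copyGadget.ncard_fourCycles_with_x s c, ?_⟩
  rw [← copyGadget.ncard_fourCycles_without_x s c, ← copyGadget.ncard_fourCycles_with_x s c,
    ← Set.ncard_union_eq _ (Set.toFinite _) (Set.toFinite _)]
  · congr 1
    ext S
    have := em (∃ v ∈ S, isXVertex v)
    push Not at this
    simp only [Set.mem_ofPred_eq, Set.mem_union]
    tauto
  · rw [Set.disjoint_left]
    rintro S ⟨-, h⟩ ⟨-, v, hv, hx⟩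
    exact h v hv hx
end
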